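/- A space X is locally realcompact (every point has an open neighborhood whose closure in X is realcompact) if and only if X is open in its Hewitt realcompactification υX. -/

import Mathlib

/-- A space is realcompact if it is homeomorphic to a closed subspace of a
product of copies of the real line. -/
def IsRealcompactSpace (Y : Type) [TopologicalSpace Y] : Prop :=
  ∃ (ι : Type) (f : Y → ι → ℝ), Topology.IsClosedEmbedding f

/-- The Hewitt realcompactification of `X`, realized inside the Stone–Čech
compactification `βX` as the intersection of all cozero-sets of `βX` containing `X`. -/
def hewitt (X : Type) [TopologicalSpace X] : Set (StoneCech X) :=
  ⋂₀ {C : Set (StoneCech X) |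
      (∃ f : StoneCech X → ℝ, Continuous f ∧ C = {x | f x ≠ 0}) ∧
        Set.range (stoneCechUnit : X → StoneCech X) ⊆ C}

open Filter Topology Set in
theorem ext_bdd {X : Type} [TopologicalSpace X] (k : X → ℝ) (hk : Continuous k)
    (hb : ∀ x, |k x| ≤ 1) :
    ∃ K : StoneCech X → ℝ, Continuous K ∧ ∀ x, K (stoneCechUnit x) = k x := by
  let k' : X → Set.Icc (-1 : ℝ) 1 := fun x => ⟨k x, abs_le.1 (hb x)⟩
  have hk' : Continuous k' := by fun_prop
  refine ⟨fun p => ((stoneCechExtend hk' p : Set.Icc (-1 : ℝ) 1) : ℝ),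
    continuous_subtype_val.comp (continuous_stoneCechExtend hk'), fun x => ?_⟩
  simp only [stoneCechExtend_stoneCechUnit]
  rfl

open Filter Topology Set in
theorem lim_of_mem_hewitt {X : Type} [TopologicalSpace X] (p : StoneCech X) (hp : p ∈ hewitt X)
    (k : X → ℝ) (hk : Continuous k) :
    ∃ l, Tendsto k (comap stoneCechUnit (𝓝 p)) (𝓝 l) := by
  have hpos : ∀ x, (0 : ℝ) < 1 + |k x| := fun x => by positivity
  obtain ⟨W, hW, hWe⟩ := ext_bdd (fun x => 1 / (1 + |k x|))
    (by fun_prop (disch := intro x; exact (hpos x).ne'))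
    (fun x => by
      rw [abs_of_pos (by have := hpos x; positivity), div_le_one (hpos x)]
      linarith [abs_nonneg (k x)])
  obtain ⟨V, hV, hVe⟩ := ext_bdd (fun x => k x / (1 + |k x|))
    (by fun_prop (disch := intro x; exact (hpos x).ne'))
    (fun x => by
      rw [abs_div, abs_of_pos (hpos x), div_le_one (hpos x)]
      linarith [abs_nonneg (k x)])
  have hWp : W p ≠ 0 := by
    refine hp {x | W x ≠ 0} ⟨⟨W, hW, rfl⟩, ?_⟩
    rintro _ ⟨x, rfl⟩
    show W _ ≠ 0
    rw [hWe]
    have := hpos x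
    positivity
  refine ⟨V p / W p, ?_⟩
  have h1 : Tendsto (fun q => V q / W q) (𝓝 p) (𝓝 (V p / W p)) :=
    hV.continuousAt.div hW.continuousAt hWp
  refine (h1.comp tendsto_comap).congr fun x => ?_
  have := (hpos x).ne'
  simp only [Function.comp, hVe, hWe]
  field_simp

open Filter Topology Set in
set_option maxHeartbeats 1000000 in
theorem dir1 (X : Type) [TopologicalSpace X] [T35Space X]
    (H : ∀ x : X, ∃ U : Set X, IsOpen U ∧ x ∈ U ∧ IsRealcompactSpace (closure U)) :
      IsOpen {y : hewitt X |
        (y : StoneCech X) ∈ Set.range (stoneCechUnit : X → StoneCech X)} := by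
  rw [isOpen_iff_mem_nhds]
  rintro ⟨_, hx'⟩ ⟨x, rfl⟩
  obtain ⟨U, hU, hxU, ι, φ, hφ⟩ := H x
  obtain ⟨f, hf, hfx, hfU⟩ := CompletelyRegularSpace.completely_regular x Uᶜ
    hU.isClosed_compl (by simpa using hxU)
  let h : X → ℝ := fun x => 1 - (f x : ℝ)
  have hh : Continuous h := by fun_prop
  have hhU : ∀ y, y ∉ U → h y = 0 := fun y hy => by
    have := hfU (show y ∈ Uᶜ from hy)
    simp [h, this]
  have hhx : h x = 1 := by simp [h, hfx]
  obtain ⟨K, hK, hKe⟩ := ext_bdd h hh (fun x => by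
    have := (f x).2
    rw [abs_le]; constructor <;> simp only [h] <;> linarith [this.1, this.2])
  have hopen : IsOpen {y : hewitt X | 0 < K y} :=
    isOpen_lt continuous_const (hK.comp continuous_subtype_val)
  refine mem_of_superset (hopen.mem_nhds ?_) ?_
  · show 0 < K _
    simp [hKe, hhx]
  rintro ⟨p, hp⟩ hKp
  have hKp : 0 < K p := hKp
  show p ∈ range _
  set 𝓕 : Filter X := comap stoneCechUnit (𝓝 p) with h𝓕
  have hne : 𝓕.NeBot := by
    rw [h𝓕, comap_neBot_iff_frequently]
    have := denseRange_stoneCechUnit (α := X) p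
    rw [mem_closure_iff_frequently] at this
    exact this
  have hht : Tendsto h 𝓕 (𝓝 (K p)) :=
    ((hK.tendsto p).comp tendsto_comap).congr fun x => hKe x
  have hev : ∀ᶠ y in 𝓕, 0 < h y := hht.eventually (lt_mem_nhds hKp)
  have hF : closure U ∈ 𝓕 := by
    filter_upwards [hev] with y hy
    apply subset_closure
    by_contra hc
    exact hy.ne' (hhU y hc)
  let G : Filter (closure U) := comap Subtype.val 𝓕
  have hG : G.NeBot := comap_coe_neBot_of_le_principal (by simpa using hF)
  have hlim : ∀ i, ∃ l, Tendsto (fun a => φ a i) G (𝓝 l) := by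
    intro i
    classical
    let k : X → ℝ := fun y => if hy : y ∈ closure U then h y * φ ⟨y, hy⟩ i else 0
    have hk1 : ContinuousOn k (closure U) := by
      rw [continuousOn_iff_continuous_domRestrict]
      have : (closure U).domRestrict k = fun a : closure U => h a * φ a i := by
        ext a
        simp [k]
      rw [this]
      have := hφ.continuous
      fun_prop
    have hk2 : ContinuousOn k Uᶜ := by
      refine (continuousOn_const (c := (0:ℝ))).congr fun y hy => ?_
      simp [k, hhU y hy]
    have hk : Continuous k := by
      have := hk1.union_of_isClosed hk2 isClosed_closure hU.isClosed_compl
      have hu : closure U ∪ Uᶜ = univ := by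
        apply eq_univ_of_forall
        intro y
        by_cases hy : y ∈ U
        · exact Or.inl (subset_closure hy)
        · exact Or.inr hy
      rw [hu] at this
      exact continuousOn_univ.1 this
    obtain ⟨l, hl⟩ := lim_of_mem_hewitt p hp k hk
    refine ⟨l / K p, ?_⟩
    have h1 : Tendsto (fun a : closure U => k a / h a) G (𝓝 (l / K p)) :=
      (hl.div hht hKp.ne').comp tendsto_comap
    refine h1.congr' ?_
    filter_upwards [tendsto_comap.eventually hev] with a ha
    simp only [k, a.2, dif_pos]
    field_simp
  choose z hz using hlim
  have hz' : Tendsto φ G (𝓝 z) := tendsto_pi_nhds.2 hz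
  obtain ⟨a, rfl⟩ : z ∈ range φ :=
    hφ.isClosed_range.mem_of_tendsto hz' (Eventually.of_forall fun a => mem_range_self a)
  have hGa : Tendsto id G (𝓝 a) := by
    rw [hφ.isInducing.tendsto_nhds_iff]; exact hz'
  refine ⟨a, ?_⟩
  have t1 : Tendsto (fun b : closure U => stoneCechUnit (b : X)) G (𝓝 (stoneCechUnit (a : X))) :=
    ((continuous_stoneCechUnit.comp continuous_subtype_val).tendsto a).comp hGa
  have t2 : Tendsto (fun b : closure U => stoneCechUnit (b : X)) G (𝓝 p) := by
    have s1 : Tendsto (stoneCechUnit : X → StoneCech X) 𝓕 (𝓝 p) := tendsto_comap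
    have s2 : Tendsto (Subtype.val : closure U → X) G 𝓕 := tendsto_comap
    exact s1.comp s2
  exact tendsto_nhds_unique t1 t2

open Filter Topology Set in
theorem dir2 (X : Type) [TopologicalSpace X] [T35Space X]
    (H : IsOpen {y : hewitt X |
        (y : StoneCech X) ∈ Set.range (stoneCechUnit : X → StoneCech X)}) :
    ∀ x : X, ∃ U : Set X, IsOpen U ∧ x ∈ U ∧ IsRealcompactSpace (closure U) := by
  intro x
  obtain ⟨W, hW, hWe⟩ := isOpen_induced_iff.1 H
  have hmem : ∀ x : X, stoneCechUnit x ∈ hewitt X := fun x C hC => hC.2 ⟨x, rfl⟩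
  have hxW : stoneCechUnit x ∈ W := by
    have : (⟨stoneCechUnit x, hmem x⟩ : hewitt X) ∈ Subtype.val ⁻¹' W := by
      rw [hWe]; exact ⟨x, rfl⟩
    exact this
  obtain ⟨C, hCn, hCc, hCW⟩ := exists_mem_nhds_isClosed_subset (hW.mem_nhds hxW)
  refine ⟨stoneCechUnit ⁻¹' (interior C), isOpen_interior.preimage continuous_stoneCechUnit,
    mem_interior_iff_mem_nhds.2 hCn, C(X, ℝ), fun a g => g a, ?_⟩
  set U : Set X := stoneCechUnit ⁻¹' (interior C) with hU
  have hFC : closure U ⊆ stoneCechUnit ⁻¹' C :=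
    closure_minimal (preimage_mono interior_subset) (hCc.preimage continuous_stoneCechUnit)
  have hcont : Continuous (fun (a : closure U) (g : C(X, ℝ)) => g a) := by fun_prop
  refine .of_continuous_injective_isClosedMap hcont ?_ (IsProperMap.isClosedMap ?_)
  · intro a b hab
    by_contra hne
    obtain ⟨g, hg, hgne⟩ := separatesPoints_continuous_of_t35Space (X := X)
      (fun h => hne (Subtype.ext h) : (a : X) ≠ b)
    exact hgne (congrFun hab ⟨g, hg⟩)
  rw [isProperMap_iff_ultrafilter]
  refine ⟨hcont, fun u y hy => ?_⟩
  rw [tendsto_pi_nhds] at hy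
  let e : closure U → StoneCech X := fun a => stoneCechUnit (a : X)
  obtain ⟨p, hp⟩ : ∃ p, Tendsto e u (𝓝 p) := ⟨_, (u.map e).le_nhds_lim⟩
  have hpC : p ∈ C := hCc.mem_of_tendsto hp (Eventually.of_forall fun a => hFC a.2)
  have hpH : p ∈ hewitt X := by
    rintro _ ⟨⟨w, hw, rfl⟩, hr⟩
    intro hwp
    have hw0 : ∀ x : X, w (stoneCechUnit x) ≠ 0 := fun x => hr ⟨x, rfl⟩
    let g : C(X, ℝ) := ⟨fun x => (w (stoneCechUnit x))⁻¹,
      (hw.comp continuous_stoneCechUnit).inv₀ hw0⟩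
    have t1 := (hy g).mul ((hw.tendsto p).comp hp)
    rw [hwp, mul_zero] at t1
    have t2 : Tendsto (fun _ : closure U => (1 : ℝ)) u (𝓝 0) := by
      refine t1.congr fun a => ?_
      exact inv_mul_cancel₀ (hw0 a)
    exact one_ne_zero (tendsto_nhds_unique tendsto_const_nhds t2)
  obtain ⟨x', rfl⟩ : p ∈ range stoneCechUnit := by
    have : (⟨p, hpH⟩ : hewitt X) ∈ Subtype.val ⁻¹' W := hCW hpC
    rw [hWe] at this
    exact this
  have ht : Tendsto (Subtype.val : closure U → X) u (𝓝 x') := by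
    rw [isInducing_stoneCechUnit.tendsto_nhds_iff]; exact hp
  have hx' : x' ∈ closure U :=
    isClosed_closure.mem_of_tendsto ht (Eventually.of_forall fun a => a.2)
  refine ⟨⟨x', hx'⟩, ?_, ?_⟩
  · ext g
    exact tendsto_nhds_unique ((g.continuous.tendsto x').comp ht) (hy g)
  · have : Tendsto id (u : Filter (closure U)) (𝓝 ⟨x', hx'⟩) := by
      rw [IsInducing.subtypeVal.tendsto_nhds_iff]; exact ht
    exact this

/-- `X` is locally realcompact iff `X` is open in `υX`. -/
theorem stmt0 (X : Type) [TopologicalSpace X] [T35Space X] :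
    (∀ x : X, ∃ U : Set X, IsOpen U ∧ x ∈ U ∧ IsRealcompactSpace (closure U)) ↔
      IsOpen {y : hewitt X |
        (y : StoneCech X) ∈ Set.range (stoneCechUnit : X → StoneCech X)} := by
  exact ⟨dir1 X, dir2 X⟩
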